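/- arXiv:1004.2884 — 6 statements merged into one kernel-verified Lean document; each statement's English description precedes it below -/
import Mathlib

section
/- For any finite set C of refinement type constraints, the IMP program ⟦Clone(C)⟧ obtained by translating the cloned constraint set Clone(C) is a read-write-once program. -/
namespace HMC

/-! ## IMP programs

Base variables and relation variables are natural numbers.  Expressions and
predicates are modelled semantically (an interpretation of the uninterpreted
functions is assumed to have been applied), as functions of the valuation of
the base variables. -/

/-- Primitive IMP commands. -/
inductive Cmd (V : Type*) where
  | assign (x : ℕ) (e : (ℕ → V) → V)            -- x := e
  | havoc  (x : ℕ)                               -- x := nondet()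
  | get    (k : ℕ) (ts : List ℕ)                 -- tuple-get from relation variable k
  | set    (k : ℕ) (xs : List ℕ)                 -- tuple-set into relation variable k
  | assume_ (p : (ℕ → V) → Prop)
  | assert_ (p : (ℕ → V) → Prop)

/-- An instruction is a finite sequence of commands. -/
abbrev Instr (V : Type*) := List (Cmd V)

/-- A program `loop { I₁ [] … [] Iₙ }` is given by its finite list of instructions. -/
abbrev Prog (V : Type*) := List (Instr V)

variable {V : Type*}

/-- Simultaneously update the base variables `ts` with the values `vs`. -/
def updList (b : ℕ → V) : List ℕ → List V → (ℕ → V)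
  | [], _ => b
  | _, [] => b
  | t :: ts, v :: vs => Function.update (updList b ts vs) t v

/-! ### Relational semantics -/

/-- A Relational state: the error state, or a map sending base variables to values
and relation variables to sets of tuples. -/
inductive RState (V : Type*) where
  | err
  | st (base : ℕ → V) (rel : ℕ → Set (List V))

/-- Relational post operator for a single command. -/
def postCmdR : RState V → Cmd V → Set (RState V)
  | .err, _ => {RState.err}
  | .st b r, .assign x e => {RState.st (Function.update b x (e b)) r}
  | .st b r, .havoc x => {σ | ∃ c : V, σ = RState.st (Function.update b x c) r}
  | .st b r, .get k ts =>
      {σ | ∃ vs ∈ r k, vs.length = ts.length ∧ σ = RState.st (updList b ts vs) r}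
  | .st b r, .set k xs => {RState.st b (Function.update r k (insert (xs.map b) (r k)))}
  | .st b r, .assume_ p => {σ | p b ∧ σ = RState.st b r}
  | .st b r, .assert_ p =>
      {σ | (p b ∧ σ = RState.st b r) ∨ (¬ p b ∧ σ = RState.err)}

/-- Relational post operator for an instruction, lifted to sets of states. -/
def postInstrR (S : Set (RState V)) : Instr V → Set (RState V)
  | [] => S
  | c :: I => postInstrR (⋃ σ ∈ S, postCmdR σ c) I

/-- Initial Relational state: relation variables hold the empty set. -/
def initR [Inhabited V] : RState V := RState.st (fun _ => default) (fun _ => ∅)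

/-- Relational states reachable in `m` loop iterations. -/
def reachRN [Inhabited V] (P : Prog V) : ℕ → Set (RState V)
  | 0 => {initR}
  | m + 1 => ⋃ I ∈ P, postInstrR (reachRN P m) I

/-- Relational-reachable states. -/
def reachR [Inhabited V] (P : Prog V) : Set (RState V) := ⋃ m, reachRN P m

/-- A program is Relational-safe if the error state is not Relational-reachable. -/
def RelSafe [Inhabited V] (P : Prog V) : Prop := RState.err ∉ reachR P

/-! ### Imperative semantics -/

/-- An Imperative state: the error state, or a map sending base variables to values
and relation variables to a single tuple or the undefined value `⊥` (`none`). -/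
inductive IState (V : Type*) where
  | err
  | st (base : ℕ → V) (rel : ℕ → Option (List V))

/-- Imperative post operator for a single command. -/
def postCmdI : IState V → Cmd V → Set (IState V)
  | .err, _ => {IState.err}
  | .st b r, .assign x e => {IState.st (Function.update b x (e b)) r}
  | .st b r, .havoc x => {σ | ∃ c : V, σ = IState.st (Function.update b x c) r}
  | .st b r, .get k ts =>
      {σ | ∃ vs, r k = some vs ∧ vs.length = ts.length ∧ σ = IState.st (updList b ts vs) r}
  | .st b r, .set k xs => {IState.st b (Function.update r k (some (xs.map b)))}
  | .st b r, .assume_ p => {σ | p b ∧ σ = IState.st b r}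
  | .st b r, .assert_ p =>
      {σ | (p b ∧ σ = IState.st b r) ∨ (¬ p b ∧ σ = IState.err)}

/-- Imperative post operator for an instruction, lifted to sets of states. -/
def postInstrI (S : Set (IState V)) : Instr V → Set (IState V)
  | [] => S
  | c :: I => postInstrI (⋃ σ ∈ S, postCmdI σ c) I

/-- Initial Imperative state: relation variables are undefined. -/
def initI [Inhabited V] : IState V := IState.st (fun _ => default) (fun _ => none)

/-- Imperative states reachable in `m` loop iterations. -/
def reachIN [Inhabited V] (P : Prog V) : ℕ → Set (IState V)
  | 0 => {initI}
  | m + 1 => ⋃ I ∈ P, postInstrI (reachIN P m) I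

/-- Imperative-reachable states. -/
def reachI [Inhabited V] (P : Prog V) : Set (IState V) := ⋃ m, reachIN P m

/-- A program is Imperative-safe if the error state is not Imperative-reachable. -/
def ImpSafe [Inhabited V] (P : Prog V) : Prop := IState.err ∉ reachI P

/-! ### Read-write-once programs -/

/-- Number of reads of relation variable `k` performed by a command. -/
def Cmd.readsK : Cmd V → ℕ → ℕ
  | .get k _, k' => if k = k' then 1 else 0
  | _, _ => 0

/-- Number of writes to relation variable `k` performed by a command. -/
def Cmd.writesK : Cmd V → ℕ → ℕ
  | .set k _, k' => if k = k' then 1 else 0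
  | _, _ => 0

/-- An instruction is read-write-once if every relation variable is read at most once
and written at most once within it. -/
def RWOnceInstr (I : Instr V) : Prop :=
  ∀ k : ℕ, (I.map (fun c => c.readsK k)).sum ≤ 1 ∧ (I.map (fun c => c.writesK k)).sum ≤ 1

/-- A program is read-write-once if each of its instructions is. -/
def RWOnce (P : Prog V) : Prop := ∀ I ∈ P, RWOnceInstr I

/-! ### Expand: relating the two semantics -/

/-- `Expand` maps a Relational state to the set of corresponding Imperative states. -/
def Expand : RState V → Set (IState V)
  | .err => {IState.err}
  | .st b r =>
      {s | ∃ f : ℕ → Option (List V), s = IState.st b f ∧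
        ∀ k, (∃ vs, f k = some vs ∧ vs ∈ r k) ∨ (f k = none ∧ r k = ∅)}

/-- `Expand` lifted to sets of Relational states. -/
def ExpandS (S : Set (RState V)) : Set (IState V) := ⋃ σ ∈ S, Expand σ

/-! ## Refinement type constraints -/

/-- A refinement: a (semantic) predicate over the program variables and the value
variable ν, or a refinement variable `κ` with pending substitutions `[x₁/y₁]…[xₙ/yₙ]`
(recording the list `y₁,…,yₙ` of substituted program variables). -/
inductive Ref (V : Type*) where
  | pred (p : (ℕ → V) → V → Prop)
  | rvar (k : ℕ) (ys : List ℕ)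

/-- A subtyping constraint `G ⊢ {ν:τ|lhs} <: {ν:τ|rhs}`. -/
structure Constraint (V : Type*) where
  env : List (ℕ × Ref V)
  lhs : Ref V
  rhs : Ref V

/-- A relational model maps each refinement variable `κ` of arity `n+1` to an
`(n+1)`-ary relation, i.e. a set of tuples. -/
abbrev RModel (V : Type*) := ℕ → Set (List V)

/-- The meaning of a refinement under a relational model `S`: a predicate over a
valuation `ρ` of the program variables and the value `v` of ν.  An occurrence
`κ[x₁/y₁]…[xₙ/yₙ]` denotes `∃ t₁…tₙ. S(κ)(v,t₁,…,tₙ) ∧ t₁ = y₁ ∧ … ∧ tₙ = yₙ`. -/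
def Ref.sem (S : RModel V) : Ref V → (ℕ → V) → V → Prop
  | .pred p, ρ, v => p ρ v
  | .rvar k ys, ρ, v => ∃ ts : List V, (v :: ts) ∈ S k ∧ ts = ys.map ρ

/-- The embedding of an environment: each binding `x : T` contributes `⟦T⟧[x/ν]`. -/
def envSem (S : RModel V) (G : List (ℕ × Ref V)) (ρ : ℕ → V) : Prop :=
  ∀ b ∈ G, Ref.sem S b.2 ρ (ρ b.1)

/-- Validity of a subtyping constraint under a relational model:
`⟦G⟧ ⇒ ⟦T₁⟧ ⇒ ⟦T₂⟧` holds for all valuations. -/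
def cvalid (S : RModel V) (c : Constraint V) : Prop :=
  ∀ (ρ : ℕ → V) (v : V), envSem S c.env ρ → Ref.sem S c.lhs ρ v → Ref.sem S c.rhs ρ v

/-- A relational model `S` satisfies (is a solution of) the constraint set `C`. -/
def Satisfies (S : RModel V) (C : List (Constraint V)) : Prop := ∀ c ∈ C, cvalid S c

/-- A constraint set is satisfiable if it admits a relational model solving it. -/
def Satisfiable (C : List (Constraint V)) : Prop := ∃ S : RModel V, Satisfies S C

/-! ## Translation of constraints to IMP programs

Base variables of the translated program: `0` encodes the value variable ν,
`2*i+1` encodes the temporary `tᵢ`, and `2*x+2` encodes the program variable `x`. -/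

/-- Encoding of the program variable `x`. -/
def pv (x : ℕ) : ℕ := 2 * x + 2

/-- Encoding of the temporary `tᵢ`. -/
def tv (i : ℕ) : ℕ := 2 * i + 1

/-- Encoding of the value variable ν. -/
def nuv : ℕ := 0

/-- Lift a refinement predicate to an IMP predicate on the encoded state. -/
def liftP (p : (ℕ → V) → V → Prop) : (ℕ → V) → Prop :=
  fun s => p (fun x => s (pv x)) (s nuv)

/-- "get" translation of a refinement: known refinements become a havoc of ν
followed by an assume; an occurrence `κ[x₁/y₁]…[xₙ/yₙ]` becomes a tuple-get
`(t₀,…,tₙ)` from `κ`, assumes `yᵢ = tᵢ`, and `ν := t₀`. -/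
def getRef : Ref V → Instr V
  | .pred p => [Cmd.havoc nuv, Cmd.assume_ (liftP p)]
  | .rvar k ys =>
      [Cmd.get k ((List.range (ys.length + 1)).map tv)] ++
      (List.range ys.length).map
        (fun i => Cmd.assume_ (fun s => s (pv (ys.getD i 0)) = s (tv (i + 1)))) ++
      [Cmd.assign nuv (fun s => s (tv 0))]

/-- "set" translation of a refinement: a known refinement becomes an assert; an
occurrence `κ[x₁/y₁]…[xₙ/yₙ]` becomes a tuple-set of `(ν,y₁,…,yₙ)` into `κ`. -/
def setRef : Ref V → Instr V
  | .pred p => [Cmd.assert_ (liftP p)]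
  | .rvar k ys => [Cmd.set k (nuv :: ys.map pv)]

/-- Translation of an environment binding `x : T`: get `T`, then `x := ν`. -/
def transBind (b : ℕ × Ref V) : Instr V :=
  getRef b.2 ++ [Cmd.assign (pv b.1) (fun s => s nuv)]

/-- Translation of a subtyping constraint `G ⊢ T₁ <: T₂`: `⟦G⟧; ⟦T₁⟧_get; ⟦T₂⟧_set`. -/
def transC (c : Constraint V) : Instr V :=
  (c.env.map transBind).flatten ++ getRef c.lhs ++ setRef c.rhs

/-- Translation of a constraint set: `loop { ⟦c₁⟧ [] … [] ⟦cₙ⟧ }`. -/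
def trans (C : List (Constraint V)) : Prog V := C.map transC

/-! ## Cloning

The clone `κⁱ` of the refinement variable `κ` is encoded as `Nat.pair κ i`. -/

/-- Number of read occurrences of `κ` in a constraint (environment bindings and LHS). -/
def readsInC (c : Constraint V) (k : ℕ) : ℕ :=
  (c.env.map (fun b =>
      match b.2 with | .rvar k' _ => if k' = k then 1 else 0 | _ => 0)).sum +
  (match c.lhs with | .rvar k' _ => if k' = k then 1 else 0 | _ => 0)

/-- The number of clones of `κ` used for the constraint set `C`: the maximum number
of times `κ` is read within some constraint of `C` (at least one). -/
def nClones (C : List (Constraint V)) (k : ℕ) : ℕ :=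
  max 1 ((C.map (fun c => readsInC c k)).foldr max 0)

/-- Replace the `i`-th read occurrence of each `κ` in the environment by the `i`-th
clone, threading per-variable counters; return the final counters as well. -/
def cloneReads : (ℕ → ℕ) → List (ℕ × Ref V) → ((ℕ → ℕ) × List (ℕ × Ref V))
  | cnt, [] => (cnt, [])
  | cnt, (x, Ref.pred p) :: rest =>
      let r := cloneReads cnt rest
      (r.1, (x, Ref.pred p) :: r.2)
  | cnt, (x, Ref.rvar k ys) :: rest =>
      let r := cloneReads (Function.update cnt k (cnt k + 1)) rest
      (r.1, (x, Ref.rvar (Nat.pair k (cnt k)) ys) :: r.2)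

/-- Clone the read occurrence (if any) on the LHS. -/
def cloneLhs (cnt : ℕ → ℕ) : Ref V → Ref V
  | .pred p => Ref.pred p
  | .rvar k ys => Ref.rvar (Nat.pair k (cnt k)) ys

/-- The cloning procedure: the `i`-th read occurrence of `κ` within any constraint
uses the clone `κⁱ`, and each constraint writing to `κ` on the RHS is replaced by
`n` copies, the `i`-th of which writes to `κⁱ`. -/
def Clone (C : List (Constraint V)) : List (Constraint V) :=
  C.flatMap (fun c =>
    let r := cloneReads (fun _ => 0) c.env
    let env' := r.2
    let lhs' := cloneLhs r.1 c.lhs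
    match c.rhs with
    | Ref.pred p => [⟨env', lhs', Ref.pred p⟩]
    | Ref.rvar k ys =>
        (List.range (nClones C k)).map
          (fun i => ⟨env', lhs', Ref.rvar (Nat.pair k i) ys⟩))

/-! ## The abstraction α -/

/-- The set of tuples stored in relation variable `k` in a Relational state. -/
def relOf : RState V → ℕ → Set (List V)
  | .err, _ => ∅
  | .st _ r, k => r k

/-- `α` maps a set of Relational states to the relational model assigning to each
`κ` the union of the sets stored in the corresponding relation variable across all
non-error states of the set. -/
def alpha (A : Set (RState V)) : RModel V := fun k => ⋃ σ ∈ A, relOf σ k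

/-- Number of times the instruction `I` reads the relation variable `k`. -/
def instrReads (I : Instr V) (k : ℕ) : ℕ := (I.map (fun c => c.readsK k)).sum

/-- Number of times the instruction `I` writes the relation variable `k`. -/
def instrWrites (I : Instr V) (k : ℕ) : ℕ := (I.map (fun c => c.writesK k)).sum

/-- Number of read occurrences (zero or one) of `k` in a refinement. -/
def Ref.occ : Ref V → ℕ → ℕ
  | .pred _, _ => 0
  | .rvar k' _, k => if k' = k then 1 else 0

lemma Ref.occ_pred (p : (ℕ → V) → V → Prop) (k : ℕ) : (Ref.pred p).occ k = 0 := rfl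

lemma Ref.occ_rvar (k' : ℕ) (ys : List ℕ) (k : ℕ) :
    (Ref.rvar k' ys : Ref V).occ k = if k' = k then 1 else 0 := rfl

lemma instrReads_append (I J : Instr V) (k : ℕ) :
    instrReads (I ++ J) k = instrReads I k + instrReads J k := by
  simp [instrReads]

lemma instrWrites_append (I J : Instr V) (k : ℕ) :
    instrWrites (I ++ J) k = instrWrites I k + instrWrites J k := by
  simp [instrWrites]

lemma instrReads_getRef (r : Ref V) (k : ℕ) : instrReads (getRef r) k = r.occ k := by
  cases r <;> simp [instrReads, getRef, Ref.occ, Cmd.readsK, Function.comp_def]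

lemma instrWrites_getRef (r : Ref V) (k : ℕ) : instrWrites (getRef r) k = 0 := by
  cases r <;> simp [instrWrites, getRef, Cmd.writesK, Function.comp_def]

lemma instrReads_setRef (r : Ref V) (k : ℕ) : instrReads (setRef r) k = 0 := by
  cases r <;> simp [instrReads, setRef, Cmd.readsK]

lemma instrWrites_setRef_le_one (r : Ref V) (k : ℕ) : instrWrites (setRef r) k ≤ 1 := by
  cases r
  · simp [instrWrites, setRef, Cmd.writesK]
  · simp only [instrWrites, setRef, Cmd.writesK, List.map_cons, List.map_nil, List.sum_cons,
      List.sum_nil]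
    split <;> simp

lemma instrReads_env (G : List (ℕ × Ref V)) (k : ℕ) :
    instrReads (G.map transBind).flatten k = (G.map (fun b => b.2.occ k)).sum := by
  induction G with
  | nil => rfl
  | cons b G ih =>
    have h : instrReads [Cmd.assign (V := V) (pv b.1) (fun s => s nuv)] k = 0 := rfl
    simp only [List.map_cons, List.flatten_cons, List.sum_cons, instrReads_append, transBind,
      instrReads_getRef, h, ih, add_zero]

lemma instrWrites_env (G : List (ℕ × Ref V)) (k : ℕ) :
    instrWrites (G.map transBind).flatten k = 0 := by
  induction G with
  | nil => rfl
  | cons b G ih =>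
    have h : instrWrites [Cmd.assign (V := V) (pv b.1) (fun s => s nuv)] k = 0 := rfl
    simp only [List.map_cons, List.flatten_cons, instrWrites_append, transBind,
      instrWrites_getRef, h, ih, add_zero]

/-- A translated constraint is read-write-once as soon as each refinement variable is read
at most once in it. -/
lemma rwOnceInstr_transC (c : Constraint V)
    (h : ∀ k, (c.env.map (fun b => b.2.occ k)).sum + c.lhs.occ k ≤ 1) :
    RWOnceInstr (transC c) := by
  intro k
  change instrReads (transC c) k ≤ 1 ∧ instrWrites (transC c) k ≤ 1
  simp only [transC, instrReads_append, instrWrites_append, instrReads_env, instrWrites_env,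
    instrReads_getRef, instrWrites_getRef, instrReads_setRef]
  exact ⟨by simpa using h k, by simpa using instrWrites_setRef_le_one c.rhs k⟩

/-- Cloning the environment only increases the counters, and uses exactly the clones
between the initial and the final counter, each of them once. -/
lemma cloneReads_occ (G : List (ℕ × Ref V)) (cnt : ℕ → ℕ) (k i : ℕ) :
    cnt k ≤ (cloneReads cnt G).1 k ∧
    ((cloneReads cnt G).2.map (fun b => b.2.occ (Nat.pair k i))).sum =
      if cnt k ≤ i ∧ i < (cloneReads cnt G).1 k then 1 else 0 := by
  induction G generalizing cnt with
  | nil =>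
    simp only [cloneReads, List.map_nil, List.sum_nil, le_refl, true_and]
    grind
  | cons b G ih =>
    obtain ⟨x, p | ⟨k', ys⟩⟩ := b
    · simp only [cloneReads, List.map_cons, List.sum_cons, Ref.occ_pred, zero_add]
      exact ih cnt
    · obtain ⟨h₁, h₂⟩ := ih (Function.update cnt k' (cnt k' + 1))
      simp only [cloneReads, List.map_cons, List.sum_cons, h₂, Ref.occ_rvar, Nat.pair_eq_pair]
      by_cases hk : k = k'
      · subst hk
        simp only [Function.update_self] at h₁ ⊢
        grind
      · simp only [Function.update_of_ne hk] at h₁ ⊢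
        grind

lemma clone_occ_le_one (G : List (ℕ × Ref V)) (r : Ref V) (k : ℕ) :
    ((cloneReads (fun _ => 0) G).2.map (fun b => b.2.occ k)).sum +
      (cloneLhs (cloneReads (fun _ => 0) G).1 r).occ k ≤ 1 := by
  obtain ⟨h₁, h₂⟩ := cloneReads_occ G (fun _ => 0) k.unpair.1 k.unpair.2
  rw [Nat.pair_unpair] at h₂
  rw [h₂]
  cases r with
  | pred p => simp only [cloneLhs, Ref.occ_pred]; grind
  | rvar k' ys =>
    simp only [cloneLhs, Ref.occ_rvar]
    by_cases hk : Nat.pair k' ((cloneReads (fun _ => 0) G).1 k') = k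
    · subst hk
      simp
    · grind

/-- **Theorem 3(1).** For any finite set `C` of refinement type constraints, the
translation of the cloned constraint set, `⟦Clone(C)⟧`, is a read-write-once program. -/
theorem clone_translation_rwonce {V : Type*} (C : List (Constraint V)) :
    RWOnce (trans (Clone C)) := by
  intro I hI
  obtain ⟨c', hc', rfl⟩ := List.mem_map.1 hI
  obtain ⟨c, -, hc⟩ := List.mem_flatMap.1 hc'
  apply rwOnceInstr_transC
  obtain ⟨G, l, p | ⟨k, ys⟩⟩ := c
  · obtain rfl := List.mem_singleton.1 hc
    exact clone_occ_le_one G l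
  · obtain ⟨i, -, rfl⟩ := List.mem_map.1 hc
    exact clone_occ_le_one G l

end HMC
end

section
/- For any finite set C of refinement type constraints, the cloned constraint set Clone(C) is satisfiable if and only if C is satisfiable. -/
namespace HMC

variable {V : Type*}

/-- Number of read occurrences (zero or one) of `κ` in a single refinement. -/
def Ref.reads : Ref V → ℕ → ℕ
  | .pred _, _ => 0
  | .rvar k' _, k => if k' = k then 1 else 0

/-- Number of read occurrences of `κ` in an environment. -/
def envReads (G : List (ℕ × Ref V)) (k : ℕ) : ℕ := (G.map (fun b => b.2.reads k)).sum

@[simp]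
theorem envReads_cons (b : ℕ × Ref V) (G : List (ℕ × Ref V)) (k : ℕ) :
    envReads (b :: G) k = b.2.reads k + envReads G k := by
  simp [envReads]

theorem readsInC_eq (c : Constraint V) (k : ℕ) :
    readsInC c k = envReads c.env k + c.lhs.reads k := by
  unfold readsInC envReads
  congr 1
  · congr 2
    funext b
    cases b.2 <;> rfl
  · cases c.lhs <;> rfl

theorem readsInC_le_nClones {C : List (Constraint V)} {c : Constraint V} (hc : c ∈ C) (k : ℕ) :
    readsInC c k ≤ nClones C k := by
  refine le_trans ?_ (le_max_right _ _)
  induction C with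
  | nil => simp at hc
  | cons d C ih =>
    simp only [List.map_cons, List.foldr_cons]
    rcases List.mem_cons.1 hc with rfl | h
    · exact le_max_left _ _
    · exact (ih h).trans (le_max_right _ _)

@[simp]
theorem sem_rvar (S : RModel V) (k : ℕ) (ys : List ℕ) (ρ : ℕ → V) (v : V) :
    Ref.sem S (.rvar k ys) ρ v ↔ (v :: ys.map ρ) ∈ S k := by
  simp [Ref.sem]

@[simp]
theorem envSem_nil (S : RModel V) (ρ : ℕ → V) : envSem S [] ρ := by
  simp [envSem]

@[simp]
theorem envSem_cons (S : RModel V) (b : ℕ × Ref V) (G : List (ℕ × Ref V)) (ρ : ℕ → V) :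
    envSem S (b :: G) ρ ↔ Ref.sem S b.2 ρ (ρ b.1) ∧ envSem S G ρ := by
  simp [envSem]

theorem cloneReads_fst (cnt : ℕ → ℕ) (G : List (ℕ × Ref V)) (k : ℕ) :
    (cloneReads cnt G).1 k = cnt k + envReads G k := by
  induction G generalizing cnt with
  | nil => rfl
  | cons b G ih =>
    obtain ⟨x, p | ⟨k', ys⟩⟩ := b
    · simp [cloneReads, ih, Ref.reads]
    · by_cases h : k' = k
      · subst h
        simp [cloneReads, ih, Ref.reads, add_assoc]
      · simp [cloneReads, ih, Ref.reads, h, Function.update_of_ne (Ne.symm h)]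

/-- The model of the clones in which every clone of `κ` is interpreted as `κ`. -/
def cloneModel (S : RModel V) : RModel V := fun k => S k.unpair.1

/-- The model interpreting `κ` as the intersection of its first `N κ` clones. -/
def meetModel (N : ℕ → ℕ) (S : RModel V) : RModel V :=
  fun k => {ts | ∀ i < N k, ts ∈ S (Nat.pair k i)}

theorem sem_cloneLhs_cloneModel (S : RModel V) (cnt : ℕ → ℕ) (r : Ref V) (ρ : ℕ → V) (v : V) :
    Ref.sem (cloneModel S) (cloneLhs cnt r) ρ v ↔ Ref.sem S r ρ v := by
  cases r <;> simp [cloneLhs, cloneModel, Ref.sem]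

theorem envSem_cloneReads_cloneModel (S : RModel V) (cnt : ℕ → ℕ) (G : List (ℕ × Ref V))
    (ρ : ℕ → V) :
    envSem (cloneModel S) (cloneReads cnt G).2 ρ ↔ envSem S G ρ := by
  induction G generalizing cnt with
  | nil => simp [cloneReads]
  | cons b G ih =>
    obtain ⟨x, p | ⟨k, ys⟩⟩ := b <;> simp [cloneReads, ih, cloneModel, Ref.sem]

theorem sem_cloneLhs_of_meetModel {N : ℕ → ℕ} {S : RModel V} {cnt : ℕ → ℕ} {r : Ref V}
    {ρ : ℕ → V} {v : V} (hN : ∀ k, cnt k + r.reads k ≤ N k)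
    (h : Ref.sem (meetModel N S) r ρ v) : Ref.sem S (cloneLhs cnt r) ρ v := by
  cases r with
  | pred p => exact h
  | rvar k ys =>
    have hk := hN k
    simp only [Ref.reads, if_true] at hk
    exact (sem_rvar ..).2 ((sem_rvar ..).1 h (cnt k) hk)

theorem envSem_cloneReads_of_meetModel {N : ℕ → ℕ} {S : RModel V} {cnt : ℕ → ℕ}
    {G : List (ℕ × Ref V)} {ρ : ℕ → V} (hN : ∀ k, cnt k + envReads G k ≤ N k)
    (h : envSem (meetModel N S) G ρ) : envSem S (cloneReads cnt G).2 ρ := by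
  induction G generalizing cnt with
  | nil => simp [cloneReads]
  | cons b G ih =>
    obtain ⟨x, p | ⟨k, ys⟩⟩ := b
    · simp only [envReads_cons, Ref.reads, zero_add] at hN
      rw [envSem_cons] at h
      exact (envSem_cons ..).2 ⟨h.1, ih hN h.2⟩
    · rw [envSem_cons] at h
      simp only [envReads_cons, Ref.reads] at hN
      refine (envSem_cons ..).2 ⟨(sem_rvar ..).2 ((sem_rvar ..).1 h.1 (cnt k) ?_), ih ?_ h.2⟩
      · have hk := hN k
        simp only [if_true] at hk
        omega
      · intro k'
        have hk := hN k'
        by_cases e : k = k'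
        · subst e
          simp only [if_true] at hk
          simp only [Function.update_self]
          omega
        · simp only [e, if_false] at hk
          simp only [Function.update_of_ne (Ne.symm e)]
          omega

/-- The copy of the constraint `c` whose reads are cloned and whose right-hand side is `r`. -/
def cloneWith (c : Constraint V) (r : Ref V) : Constraint V :=
  ⟨(cloneReads (fun _ => 0) c.env).2, cloneLhs (cloneReads (fun _ => 0) c.env).1 c.lhs, r⟩

theorem mem_Clone {C : List (Constraint V)} {d : Constraint V} :
    d ∈ Clone C ↔ ∃ c ∈ C, (∃ p, c.rhs = .pred p ∧ d = cloneWith c (.pred p)) ∨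
      ∃ k ys, c.rhs = .rvar k ys ∧
        ∃ i < nClones C k, d = cloneWith c (.rvar (Nat.pair k i) ys) := by
  simp only [Clone, List.mem_flatMap]
  refine exists_congr fun c => and_congr_right fun _ => ?_
  cases c.rhs <;> simp [cloneWith, eq_comm]

theorem cvalid_of_cloneWith {N : ℕ → ℕ} {S : RModel V} {c : Constraint V} {r : Ref V}
    (hN : ∀ k, readsInC c k ≤ N k) (h : cvalid S (cloneWith c r)) {ρ : ℕ → V} {v : V}
    (hG : envSem (meetModel N S) c.env ρ) (hl : Ref.sem (meetModel N S) c.lhs ρ v) :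
    Ref.sem S r ρ v := by
  simp only [readsInC_eq] at hN
  refine h ρ v (envSem_cloneReads_of_meetModel (fun k => ?_) hG)
    (sem_cloneLhs_of_meetModel (fun k => ?_) hl)
  · have := hN k
    omega
  · rw [cloneReads_fst, zero_add]
    exact hN k

theorem Satisfies.meetModel {C : List (Constraint V)} {S : RModel V}
    (h : Satisfies S (Clone C)) : Satisfies (meetModel (nClones C) S) C := by
  intro c hc ρ v hG hl
  have hN := readsInC_le_nClones hc
  cases hr : c.rhs with
  | pred p =>
    exact cvalid_of_cloneWith hN (h _ (mem_Clone.2 ⟨c, hc, .inl ⟨p, hr, rfl⟩⟩)) hG hl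
  | rvar k ys =>
    refine (sem_rvar ..).2 fun i hi => (sem_rvar ..).1 <|
      cvalid_of_cloneWith hN (h _ (mem_Clone.2 ⟨c, hc, .inr ⟨k, ys, hr, i, hi, rfl⟩⟩)) hG hl

theorem Satisfies.cloneModel {C : List (Constraint V)} {S : RModel V}
    (h : Satisfies S C) : Satisfies (cloneModel S) (Clone C) := by
  intro d hd ρ v hG hl
  obtain ⟨c, hc, ⟨p, hr, rfl⟩ | ⟨k, ys, hr, i, -, rfl⟩⟩ := mem_Clone.1 hd
  all_goals
    have hv := h c hc ρ v ((envSem_cloneReads_cloneModel ..).1 hG)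
      ((sem_cloneLhs_cloneModel ..).1 hl)
    rw [hr] at hv
  · exact hv
  · simpa [cloneWith, HMC.cloneModel] using hv

/-- **Theorem 3(2).** For any finite set `C` of refinement type constraints, the
cloned constraint set `Clone(C)` is satisfiable iff `C` is satisfiable. -/
theorem clone_satisfiable_iff {V : Type*} (C : List (Constraint V)) :
    Satisfiable (Clone C) ↔ Satisfiable C := by
  exact ⟨fun ⟨_, h⟩ => ⟨_, h.meetModel⟩, fun ⟨_, h⟩ => ⟨_, h.cloneModel⟩⟩

end HMC
end

section
/- If S₁ and S₂ are relational models that both satisfy a set C of refinement type constraints, then their pointwise intersection S₁ ∩ S₂, defined by (S₁ ∩ S₂)(κ) = S₁(κ) ∩ S₂(κ) for each refinement variable κ, also satisfies C. -/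
namespace HMC

variable {V : Type*}

theorem Ref.sem_mono {S T : RModel V} (h : ∀ k, S k ⊆ T k) {r : Ref V} {ρ : ℕ → V} {v : V}
    (hr : Ref.sem S r ρ v) : Ref.sem T r ρ v := by
  cases r with
  | pred p => exact hr
  | rvar k ys => exact hr.imp fun _ hts => ⟨h k hts.1, hts.2⟩

theorem envSem_mono {S T : RModel V} (h : ∀ k, S k ⊆ T k) {G : List (ℕ × Ref V)} {ρ : ℕ → V}
    (hG : envSem S G ρ) : envSem T G ρ :=
  fun b hb => Ref.sem_mono h (hG b hb)

theorem Ref.sem_inter {S₁ S₂ : RModel V} {r : Ref V} {ρ : ℕ → V} {v : V}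
    (h₁ : Ref.sem S₁ r ρ v) (h₂ : Ref.sem S₂ r ρ v) :
    Ref.sem (fun k => S₁ k ∩ S₂ k) r ρ v := by
  cases r with
  | pred p => exact h₁
  | rvar k ys =>
    obtain ⟨_, hm₁, rfl⟩ := h₁
    obtain ⟨_, hm₂, rfl⟩ := h₂
    exact ⟨_, ⟨hm₁, hm₂⟩, rfl⟩

/-- **Lemma (Intersection of solutions).** If `S₁` and `S₂` are relational models
both satisfying the constraint set `C`, then their pointwise intersection also
satisfies `C`. -/
theorem satisfies_inter {V : Type*} (C : List (Constraint V)) (S₁ S₂ : RModel V)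
    (h₁ : Satisfies S₁ C) (h₂ : Satisfies S₂ C) :
    Satisfies (fun k => S₁ k ∩ S₂ k) C := by
  intro c hc ρ v hG hl
  have hs₁ (k : ℕ) : S₁ k ∩ S₂ k ⊆ S₁ k := Set.inter_subset_left
  have hs₂ (k : ℕ) : S₁ k ∩ S₂ k ⊆ S₂ k := Set.inter_subset_right
  exact Ref.sem_inter
    (h₁ c hc ρ v (envSem_mono hs₁ hG) (Ref.sem_mono hs₁ hl))
    (h₂ c hc ρ v (envSem_mono hs₂ hG) (Ref.sem_mono hs₂ hl))

end HMC
end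

section
/- For any IMP instruction I (not necessarily read-write-once) and any Relational state σ♯, Post(Expand(σ♯), I) ⊆ Expand(Post♯(σ♯, I)), where Post♯ and Post are the Relational and Imperative post operators lifted to sets of states. -/
namespace HMC

variable {V : Type*}

/-- Every Imperative step from an expansion of `σ` is matched by a Relational step from `σ`. -/
theorem exists_mem_postCmdR_of_mem_postCmdI {V : Type*} {σ : RState V} {s t : IState V}
    {c : Cmd V} (hs : s ∈ Expand σ) (ht : t ∈ postCmdI s c) :
    ∃ τ ∈ postCmdR σ c, t ∈ Expand τ := by
  cases σ with
  | err =>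
    obtain rfl : s = IState.err := hs
    obtain rfl : t = IState.err := by cases c <;> exact ht
    exact ⟨RState.err, by cases c <;> rfl, rfl⟩
  | st b r =>
    obtain ⟨f, rfl, hf⟩ := hs
    cases c with
    | assign x e =>
      obtain rfl := ht
      exact ⟨_, rfl, f, rfl, hf⟩
    | havoc x =>
      obtain ⟨v, rfl⟩ := ht
      exact ⟨_, ⟨v, rfl⟩, f, rfl, hf⟩
    | get k ts =>
      obtain ⟨vs, hk, hlen, rfl⟩ := ht
      have hmem : vs ∈ r k := by
        rcases hf k with ⟨ws, hws, hr⟩ | ⟨hnone, -⟩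
        · rw [hk] at hws
          cases hws
          exact hr
        · rw [hk] at hnone
          cases hnone
      exact ⟨_, ⟨vs, hmem, hlen, rfl⟩, f, rfl, hf⟩
    | set k xs =>
      obtain rfl := ht
      refine ⟨_, rfl, _, rfl, fun j => ?_⟩
      rcases eq_or_ne j k with rfl | hj
      · exact Or.inl ⟨xs.map b, by simp, by simp⟩
      · simpa only [Function.update_of_ne hj] using hf j
    | assume_ p =>
      obtain ⟨hp, rfl⟩ := ht
      exact ⟨_, ⟨hp, rfl⟩, f, rfl, hf⟩
    | assert_ p =>
      rcases ht with ⟨hp, rfl⟩ | ⟨hp, rfl⟩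
      · exact ⟨_, Or.inl ⟨hp, rfl⟩, f, rfl, hf⟩
      · exact ⟨_, Or.inr ⟨hp, rfl⟩, rfl⟩

/-- The Imperative post operator preserves over-approximation by a set of Relational states. -/
theorem postInstrI_subset_expandS {V : Type*} (I : Instr V) {S : Set (IState V)}
    {T : Set (RState V)} (h : S ⊆ ExpandS T) :
    postInstrI S I ⊆ ExpandS (postInstrR T I) := by
  induction I generalizing S T with
  | nil => exact h
  | cons c I ih =>
    refine ih fun t ht => ?_
    obtain ⟨s, hs, hst⟩ := Set.mem_iUnion₂.mp ht
    obtain ⟨σ, hσ, hsσ⟩ := Set.mem_iUnion₂.mp (h hs)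
    obtain ⟨τ, hτ, htτ⟩ := exists_mem_postCmdR_of_mem_postCmdI hsσ hst
    exact Set.mem_iUnion₂.mpr ⟨τ, Set.mem_iUnion₂.mpr ⟨σ, hσ, hτ⟩, htτ⟩

/-- For any IMP instruction `I` (not necessarily read-write-once) and any
Relational state `σ♯`, `Post(Expand(σ♯), I) ⊆ Expand(Post♯(σ♯, I))`. -/
theorem post_expand_subset_expand_post {V : Type*} (I : Instr V) (σ : RState V) :
    postInstrI (Expand σ) I ⊆ ExpandS (postInstrR {σ} I) := by
  exact postInstrI_subset_expandS I fun _ hs => Set.mem_iUnion₂.mpr ⟨σ, rfl, hs⟩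

end HMC
end

section
/- For any IMP program P (not necessarily read-write-once) and every m ∈ ℕ, Reach(P, m) ⊆ Expand(Reach♯(P)): every Imperative state reachable in m loop iterations lies in the Expand-image of the Relational-reachable states. -/
namespace HMC

variable {V : Type*}

/-- One command preserves the simulation given by `Expand`. -/
theorem postCmdI_subset_ExpandS {s : IState V} {σ : RState V} (h : s ∈ Expand σ) (c : Cmd V) :
    postCmdI s c ⊆ ExpandS (postCmdR σ c) := by
  intro s' hs'
  simp only [ExpandS, Set.mem_iUnion, exists_prop]
  cases σ with
  | err =>
    obtain rfl : s = IState.err := h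
    exact ⟨RState.err, by simp [postCmdR], hs'⟩
  | st b r =>
    obtain ⟨f, rfl, hf⟩ := h
    cases c with
    | assign x e => exact ⟨_, rfl, f, hs', hf⟩
    | havoc x =>
      obtain ⟨v, rfl⟩ := hs'
      exact ⟨_, ⟨v, rfl⟩, f, rfl, hf⟩
    | get k ts =>
      obtain ⟨vs, hk, hlen, rfl⟩ := hs'
      have hvs : vs ∈ r k := by
        rcases hf k with ⟨ws, hws, hmem⟩ | ⟨hnone, -⟩
        · rw [hk, Option.some.injEq] at hws
          exact hws ▸ hmem
        · simp [hk] at hnone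
      exact ⟨_, ⟨vs, hvs, hlen, rfl⟩, f, rfl, hf⟩
    | set k xs =>
      refine ⟨_, rfl, _, hs', fun j => ?_⟩
      by_cases hj : j = k
      · subst hj
        exact Or.inl ⟨xs.map b, by simp, by simp⟩
      · simpa [Function.update_of_ne hj] using hf j
    | assume_ p =>
      obtain ⟨hp, rfl⟩ := hs'
      exact ⟨_, ⟨hp, rfl⟩, f, rfl, hf⟩
    | assert_ p =>
      rcases hs' with ⟨hp, rfl⟩ | ⟨hp, rfl⟩
      · exact ⟨_, Or.inl ⟨hp, rfl⟩, f, rfl, hf⟩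
      · exact ⟨_, Or.inr ⟨hp, rfl⟩, rfl⟩

/-- An instruction preserves the simulation given by `Expand`. -/
theorem postInstrI_subset_ExpandS (I : Instr V) {S : Set (IState V)} {A : Set (RState V)}
    (h : S ⊆ ExpandS A) : postInstrI S I ⊆ ExpandS (postInstrR A I) := by
  induction I generalizing S A with
  | nil => exact h
  | cons c I ih =>
    refine ih (Set.iUnion₂_subset fun s hs => ?_)
    obtain ⟨σ, hσ, hsσ⟩ := Set.mem_iUnion₂.1 (h hs)
    exact (postCmdI_subset_ExpandS hsσ c).trans
      (Set.biUnion_subset_biUnion_left (Set.subset_biUnion_of_mem (u := (postCmdR · c)) hσ))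

/-- Imperative states reachable in `m` iterations expand from Relational states reachable in
the same number of iterations. -/
theorem reachIN_subset_ExpandS_reachRN [Inhabited V] (P : Prog V) (m : ℕ) :
    reachIN P m ⊆ ExpandS (reachRN P m) := by
  induction m with
  | zero =>
    rintro s rfl
    exact Set.mem_iUnion₂.2 ⟨initR, rfl, _, rfl, fun _ => Or.inr ⟨rfl, rfl⟩⟩
  | succ m ih =>
    refine Set.iUnion₂_subset fun I hI => (postInstrI_subset_ExpandS I ih).trans ?_
    exact Set.biUnion_subset_biUnion_left
      (Set.subset_biUnion_of_mem (s := {I | I ∈ P}) (u := postInstrR (reachRN P m)) hI)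

/-- For any IMP program `P` (not necessarily read-write-once) and every `m`,
`Reach(P, m) ⊆ Expand(Reach♯(P))`. -/
theorem reachN_subset_expand_reach
    {V : Type*} [Inhabited V] (P : Prog V) (m : ℕ) :
    reachIN P m ⊆ ExpandS (reachR P) := by
  exact (reachIN_subset_ExpandS_reachRN P m).trans
    (Set.biUnion_subset_biUnion_left (Set.subset_iUnion (reachRN P) m))

end HMC
end

section
/- Let P be the IMP program over integer values with one unary relation variable κ, loop{ (havoc ν; tuple-set κ ← (ν)) [] (tuple-get κ ▷ t₀; ν := t₀; x := ν; tuple-get κ ▷ t₀; ν := t₀; y := ν; assert(x = y)) }. Then P is not Relational-safe, but P is Imperative-safe. In particular, the Relational and Imperative semantics of IMP programs are not equivalent for programs that are not read-write-once. -/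
namespace HMC

variable {V : Type*}

/-- The counterexample program over the integers, with one unary relation variable
`κ` (index `0`) and base variables `ν = 0`, `t₀ = 1`, `x = 2`, `y = 3`:
`loop{ (havoc ν; κ ← (ν)) []
       (κ ▷ (t₀); ν := t₀; x := ν; κ ▷ (t₀); ν := t₀; y := ν; assert(x = y)) }`. -/
def P13 : Prog ℤ :=
  [ [Cmd.havoc 0, Cmd.set 0 [0]],
    [Cmd.get 0 [1], Cmd.assign 0 (fun s => s 1), Cmd.assign 2 (fun s => s 0),
     Cmd.get 0 [1], Cmd.assign 0 (fun s => s 1), Cmd.assign 3 (fun s => s 0),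
     Cmd.assert_ (fun s => s 2 = s 3)] ]

theorem mem_postInstrR_iff {S : Set (RState V)} {I : Instr V} {τ : RState V} :
    τ ∈ postInstrR S I ↔ ∃ σ ∈ S, τ ∈ postInstrR {σ} I := by
  induction I generalizing S with
  | nil => simp [postInstrR]
  | cons c I ih =>
    simp only [postInstrR]
    rw [ih]
    constructor
    · rintro ⟨ρ, hρ, h⟩
      obtain ⟨σ, hσ, hc⟩ := Set.mem_iUnion₂.1 hρ
      exact ⟨σ, hσ, ih.2 ⟨ρ, by simpa using hc, h⟩⟩
    · rintro ⟨σ, hσ, h⟩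
      obtain ⟨ρ, hρ, h⟩ := ih.1 h
      exact ⟨ρ, Set.mem_iUnion₂.2 ⟨σ, hσ, by simpa using hρ⟩, h⟩

theorem mem_postInstrR_singleton_cons {σ : RState V} {c : Cmd V} {I : Instr V} {τ : RState V} :
    τ ∈ postInstrR {σ} (c :: I) ↔ ∃ ρ ∈ postCmdR σ c, τ ∈ postInstrR {ρ} I := by
  rw [postInstrR, mem_postInstrR_iff]
  simp

theorem mem_postInstrI_iff {S : Set (IState V)} {I : Instr V} {τ : IState V} :
    τ ∈ postInstrI S I ↔ ∃ σ ∈ S, τ ∈ postInstrI {σ} I := by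
  induction I generalizing S with
  | nil => simp [postInstrI]
  | cons c I ih =>
    simp only [postInstrI]
    rw [ih]
    constructor
    · rintro ⟨ρ, hρ, h⟩
      obtain ⟨σ, hσ, hc⟩ := Set.mem_iUnion₂.1 hρ
      exact ⟨σ, hσ, ih.2 ⟨ρ, by simpa using hc, h⟩⟩
    · rintro ⟨σ, hσ, h⟩
      obtain ⟨ρ, hρ, h⟩ := ih.1 h
      exact ⟨ρ, Set.mem_iUnion₂.2 ⟨σ, hσ, by simpa using hρ⟩, h⟩

theorem mem_postInstrI_singleton_cons {σ : IState V} {c : Cmd V} {I : Instr V} {τ : IState V} :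
    τ ∈ postInstrI {σ} (c :: I) ↔ ∃ ρ ∈ postCmdI σ c, τ ∈ postInstrI {ρ} I := by
  rw [postInstrI, mem_postInstrI_iff]
  simp

theorem mem_reachRN_succ [Inhabited V] {P : Prog V} {m : ℕ} {I : Instr V} (hI : I ∈ P)
    {σ τ : RState V} (hσ : σ ∈ reachRN P m) (h : τ ∈ postInstrR {σ} I) :
    τ ∈ reachRN P (m + 1) :=
  Set.mem_iUnion₂.2 ⟨I, hI, mem_postInstrR_iff.2 ⟨σ, hσ, h⟩⟩

/-- One iteration of the writing instruction of `P13` can insert any value into `κ`. -/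
theorem P13_reachRN_insert {m : ℕ} {b : ℕ → ℤ} {r : ℕ → Set (List ℤ)}
    (h : RState.st b r ∈ reachRN P13 m) (c : ℤ) :
    RState.st (Function.update b 0 c) (Function.update r 0 (insert [c] (r 0)))
      ∈ reachRN P13 (m + 1) := by
  refine mem_reachRN_succ (I := [Cmd.havoc 0, Cmd.set 0 [0]]) (by simp [P13]) h ?_
  rw [mem_postInstrR_singleton_cons]
  refine ⟨_, ⟨c, rfl⟩, ?_⟩
  simp [postCmdR, postInstrR]

/-- If `κ` contains two distinct values, the reading instruction of `P13` can fail. -/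
theorem P13_reachRN_err {m : ℕ} {b : ℕ → ℤ} {r : ℕ → Set (List ℤ)}
    (h : RState.st b r ∈ reachRN P13 m) {c d : ℤ} (hc : [c] ∈ r 0) (hd : [d] ∈ r 0)
    (hcd : c ≠ d) : RState.err ∈ reachRN P13 (m + 1) := by
  refine mem_reachRN_succ (List.mem_cons_of_mem _ (List.mem_singleton_self _)) h ?_
  rw [mem_postInstrR_singleton_cons]
  refine ⟨_, ⟨[c], hc, rfl, rfl⟩, ?_⟩
  rw [mem_postInstrR_singleton_cons]
  refine ⟨_, rfl, ?_⟩
  rw [mem_postInstrR_singleton_cons]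
  refine ⟨_, rfl, ?_⟩
  rw [mem_postInstrR_singleton_cons]
  refine ⟨_, ⟨[d], hd, rfl, rfl⟩, ?_⟩
  rw [mem_postInstrR_singleton_cons]
  refine ⟨_, rfl, ?_⟩
  rw [mem_postInstrR_singleton_cons]
  refine ⟨_, rfl, ?_⟩
  rw [mem_postInstrR_singleton_cons]
  exact ⟨_, Or.inr ⟨by simpa [updList, Function.update_apply] using hcd, rfl⟩, rfl⟩

theorem P13_not_relSafe : ¬ RelSafe P13 := by
  have h₀ : RState.st (fun _ => default) (fun _ => ∅) ∈ reachRN P13 0 := rfl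
  have h₂ := P13_reachRN_insert (P13_reachRN_insert h₀ 0) 1
  exact fun hsafe => hsafe <| Set.mem_iUnion.2
    ⟨_, P13_reachRN_err h₂ (c := 0) (d := 1) (by simp) (by simp) (by simp)⟩

/-- No instruction of `P13` fails in the Imperative semantics: both reads of `κ` return the
same tuple. -/
theorem P13_err_notMem_postInstrI {I : Instr ℤ} (hI : I ∈ P13) (b : ℕ → ℤ)
    (r : ℕ → Option (List ℤ)) : IState.err ∉ postInstrI {IState.st b r} I := by
  simp only [P13, List.mem_cons, List.not_mem_nil, or_false] at hI
  rcases hI with rfl | rfl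
  · simp only [mem_postInstrI_singleton_cons]
    rintro ⟨_, ⟨c, rfl⟩, _, rfl, h⟩
    cases h
  · simp only [mem_postInstrI_singleton_cons]
    rintro ⟨_, ⟨vs, hvs, hlen, rfl⟩, _, rfl, _, rfl, _, ⟨ws, hws, -, rfl⟩, _, rfl, _, rfl, _,
      ⟨-, rfl⟩ | ⟨hne, rfl⟩, h⟩
    · cases h
    · obtain rfl : vs = ws := Option.some.inj (hvs.symm.trans hws)
      obtain ⟨v, rfl⟩ := List.length_eq_one_iff.1 hlen
      simp [updList] at hne

theorem P13_impSafe : ImpSafe P13 := by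
  intro h
  obtain ⟨m, h⟩ := Set.mem_iUnion.1 h
  induction m with
  | zero => cases h
  | succ m ih =>
    obtain ⟨I, hI, h⟩ := Set.mem_iUnion₂.1 h
    obtain ⟨σ, hσ, h⟩ := mem_postInstrI_iff.1 h
    cases σ with
    | err => exact ih hσ
    | st b r => exact P13_err_notMem_postInstrI hI b r h

/-- `P13` is not Relational-safe but is Imperative-safe; in particular, the
Relational and Imperative semantics are not equivalent for programs that are not
read-write-once. -/
theorem relational_imperative_not_equivalent :
    ¬ RelSafe P13 ∧ ImpSafe P13 ∧ ¬ (RelSafe P13 ↔ ImpSafe P13) := by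
  exact ⟨P13_not_relSafe, P13_impSafe, fun h => P13_not_relSafe (h.2 P13_impSafe)⟩

end HMC
end
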